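/- Let Γ be a monoid, R a commutative ring with identity, A a Γ-graded associative R-algebra, and B a Γ-algebra. Suppose N is a B-module which is flat and finitely generated as an R-module, and such that for every β ∈ Γ the B-module _β N (action b ·_β x = b^β x) is projective. Then the functor − ⋉_Γ N from the category A-Γ-gr to the category of Γ-graded A ⋉_Γ B-modules preserves minimal projective resolutions: if P_• → M → 0 is a minimal projective resolution in A-Γ-gr, then P_• ⋉_Γ N → M ⋉_Γ N → 0 is a minimal projective resolution in (A ⋉_Γ B)-Γ-gr. -/

import Mathlib

open DirectSum TensorProduct

universe u

variable (Γ : Type u) [Monoid Γ] [DecidableEq Γ] (R : Type u) [CommRing R]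
  (A : Type u) [Ring A] [Algebra R A]

/-- A `Γ`-grading on the `R`-algebra `A`: an internal direct sum decomposition
`A = ⊕_{γ ∈ Γ} A_γ` into `R`-submodules with `1 ∈ A_e` and `A_γ · A_δ ⊆ A_{γδ}`. -/
structure GrAlgebra : Type (u + 1) where
  grading : Γ → Submodule R A
  internal : DirectSum.IsInternal grading
  one_mem : (1 : A) ∈ grading 1
  mul_mem : ∀ {γ δ : Γ} {a b : A},
    a ∈ grading γ → b ∈ grading δ → a * b ∈ grading (γ * δ)

variable (B : Type u) [Ring B] [Algebra R B]

/-- A `Γ`-algebra: an `R`-algebra `B` together with a right action of the monoid `Γ` on `B`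
by `R`-algebra endomorphisms, written `b ↦ b^γ = (act γ) b`. -/
structure GammaAlgebra : Type u where
  act : Γ → B →ₐ[R] B
  act_one : act 1 = AlgHom.id R B
  act_mul : ∀ γ δ : Γ, act (γ * δ) = (act δ).comp (act γ)

variable {Γ R A B}

/-- A `Γ`-graded left `A`-module: the objects of the category `A`-`Γ`-gr. -/
structure GrMod (𝒜 : GrAlgebra Γ R A) : Type (u + 1) where
  carrier : Type u
  [acg : AddCommGroup carrier]
  [modR : Module R carrier]
  [modA : Module A carrier]
  [tower : IsScalarTower R A carrier]
  grading : Γ → Submodule R carrier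
  internal : DirectSum.IsInternal grading
  smul_mem : ∀ {γ δ : Γ} {a : A} {m : carrier},
    a ∈ 𝒜.grading γ → m ∈ grading δ → a • m ∈ grading (γ * δ)

attribute [instance] GrMod.acg GrMod.modR GrMod.modA GrMod.tower

/-- Morphisms of the category `A`-`Γ`-gr. -/
structure GrHom {𝒜 : GrAlgebra Γ R A} (M N : GrMod 𝒜) where
  toLin : M.carrier →ₗ[A] N.carrier
  map_grading : ∀ γ : Γ, ∀ m ∈ M.grading γ, toLin m ∈ N.grading γ

/-- Projectivity in the category `A`-`Γ`-gr (lifting property against surjective graded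
homomorphisms). -/
def GrProjective {𝒜 : GrAlgebra Γ R A} (P : GrMod 𝒜) : Prop :=
  ∀ (M N : GrMod 𝒜) (f : GrHom M N) (g : GrHom P N),
    Function.Surjective f.toLin →
    ∃ h : GrHom P M, f.toLin.comp h.toLin = g.toLin

/-- Graded `A`-submodules of a graded module. -/
def IsGrSubmodule {𝒜 : GrAlgebra Γ R A} (M : GrMod 𝒜) (T : Submodule A M.carrier) : Prop :=
  (⨆ γ : Γ, M.grading γ ⊓ T.restrictScalars R) = T.restrictScalars R

/-- `N` is a superfluous subobject of `M` in the category `A`-`Γ`-gr. -/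
def GrSuperfluous {𝒜 : GrAlgebra Γ R A} (M : GrMod 𝒜) (N : Submodule A M.carrier) : Prop :=
  ∀ T : Submodule A M.carrier, IsGrSubmodule M T → N ⊔ T = ⊤ → T = ⊤

/-- The `B`-module `_β N`: same underlying abelian group as `N`, with the `B`-action
`b ·_β x = b^β • x`. -/
def TwistB (ρ : GammaAlgebra Γ R B) (β : Γ) (N : Type u) : Type u := N

instance (ρ : GammaAlgebra Γ R B) (β : Γ) (N : Type u) [AddCommGroup N] :
    AddCommGroup (TwistB ρ β N) := inferInstanceAs (AddCommGroup N)

instance (ρ : GammaAlgebra Γ R B) (β : Γ) (N : Type u) [AddCommGroup N] [Module R N] :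
    Module R (TwistB ρ β N) := inferInstanceAs (Module R N)

instance (ρ : GammaAlgebra Γ R B) (β : Γ) (N : Type u) [AddCommGroup N] [Module B N] :
    Module B (TwistB ρ β N) := Module.compHom N (ρ.act β).toRingHom

/-- A `Γ`-graded module over the twisted product `A ⋉_Γ B`, where the multiplication of
`A ⋉_Γ B` on the underlying `R`-module `A ⊗[R] B` is the given bilinear map `mul`.
The data is an `R`-bilinear action of `A ⊗[R] B` which is unital and multiplicative for
`mul`, together with an internal grading compatible with the grading of `A ⋉_Γ B`. -/
structure TwModStr (𝒜 : GrAlgebra Γ R A)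
    (mul : (A ⊗[R] B) →ₗ[R] (A ⊗[R] B) →ₗ[R] (A ⊗[R] B))
    (X : Type u) [AddCommGroup X] [Module R X] : Type u where
  act : (A ⊗[R] B) →ₗ[R] X →ₗ[R] X
  one_act : ∀ x : X, act ((1 : A) ⊗ₜ[R] (1 : B)) x = x
  mul_act : ∀ (p q : A ⊗[R] B) (x : X), act (mul p q) x = act p (act q x)
  grading : Γ → Submodule R X
  internal : DirectSum.IsInternal grading
  act_mem : ∀ {γ δ : Γ} {a : A} {b : B} {x : X},
    a ∈ 𝒜.grading γ → x ∈ grading δ → act (a ⊗ₜ[R] b) x ∈ grading (γ * δ)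

/-- Morphisms in the category `(A ⋉_Γ B)`-`Γ`-gr: `R`-linear, `A ⋉_Γ B`-equivariant and
degree preserving maps. -/
def IsTwHom {𝒜 : GrAlgebra Γ R A}
    {mul : (A ⊗[R] B) →ₗ[R] (A ⊗[R] B) →ₗ[R] (A ⊗[R] B)}
    {X Y : Type u} [AddCommGroup X] [Module R X] [AddCommGroup Y] [Module R Y]
    (sX : TwModStr 𝒜 mul X) (sY : TwModStr 𝒜 mul Y) (f : X →ₗ[R] Y) : Prop :=
  (∀ (p : A ⊗[R] B) (x : X), f (sX.act p x) = sY.act p (f x)) ∧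
  (∀ γ : Γ, ∀ x ∈ sX.grading γ, f x ∈ sY.grading γ)

/-- Graded `A ⋉_Γ B`-submodules: `R`-submodules stable under the action and equal to the
sum of their homogeneous components. -/
def IsTwSubmodule {𝒜 : GrAlgebra Γ R A}
    {mul : (A ⊗[R] B) →ₗ[R] (A ⊗[R] B) →ₗ[R] (A ⊗[R] B)}
    {X : Type u} [AddCommGroup X] [Module R X]
    (sX : TwModStr 𝒜 mul X) (T : Submodule R X) : Prop :=
  (∀ (p : A ⊗[R] B), ∀ x ∈ T, sX.act p x ∈ T) ∧
  (⨆ γ : Γ, sX.grading γ ⊓ T) = T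

/-- Projectivity in the category `(A ⋉_Γ B)`-`Γ`-gr (lifting property against surjective
graded homomorphisms). -/
def TwProjective {𝒜 : GrAlgebra Γ R A}
    {mul : (A ⊗[R] B) →ₗ[R] (A ⊗[R] B) →ₗ[R] (A ⊗[R] B)}
    {P : Type u} [AddCommGroup P] [Module R P] (sP : TwModStr 𝒜 mul P) : Prop :=
  ∀ (X Y : Type u) [AddCommGroup X] [Module R X] [AddCommGroup Y] [Module R Y],
    ∀ (sX : TwModStr 𝒜 mul X) (sY : TwModStr 𝒜 mul Y)
      (f : X →ₗ[R] Y) (g : P →ₗ[R] Y),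
      IsTwHom sX sY f → Function.Surjective f → IsTwHom sP sY g →
      ∃ h : P →ₗ[R] X, IsTwHom sP sX h ∧ f.comp h = g

/-- The isomorphism from the external to the internal direct sum given by a grading. -/
noncomputable def gradedEquiv {Γ R X : Type*} [DecidableEq Γ] [CommRing R] [AddCommGroup X]
    [Module R X] {G : Γ → Submodule R X} (h : DirectSum.IsInternal G) :
    (DirectSum Γ fun i => G i) ≃ₗ[R] X :=
  LinearEquiv.ofBijective (DirectSum.coeLinearMap G) h

/-- The projection of a module with internal grading `G` onto its component of degree `γ`. -/
noncomputable def gradedProj {Γ R X : Type*} [DecidableEq Γ] [CommRing R] [AddCommGroup X]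
    [Module R X] {G : Γ → Submodule R X} (h : DirectSum.IsInternal G) (γ : Γ) : X →ₗ[R] X :=
  (G γ).subtype ∘ₗ DirectSum.component R Γ (fun i => G i) γ ∘ₗ
    (gradedEquiv h).symm.toLinearMap

section GradedProj

variable {Γ R X Y : Type*} [DecidableEq Γ] [CommRing R] [AddCommGroup X] [Module R X]
  [AddCommGroup Y] [Module R Y] {G : Γ → Submodule R X} {G' : Γ → Submodule R Y}

theorem gradedProj_mem (h : DirectSum.IsInternal G) (γ : Γ) (x : X) : gradedProj h γ x ∈ G γ := by
  simp [gradedProj]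

theorem gradedEquiv_symm_of_mem (h : DirectSum.IsInternal G) {γ : Γ} {x : X} (hx : x ∈ G γ) :
    (gradedEquiv h).symm x =
      DirectSum.lof R Γ (fun i => G i) γ ⟨x, hx⟩ := by
  rw [LinearEquiv.symm_apply_eq]
  exact (DirectSum.coeLinearMap_lof G γ ⟨x, hx⟩).symm

theorem gradedProj_of_mem (h : DirectSum.IsInternal G) {γ : Γ} {x : X} (hx : x ∈ G γ) :
    gradedProj h γ x = x := by
  simp [gradedProj, gradedEquiv_symm_of_mem h hx, DirectSum.component.lof_self]

theorem gradedProj_of_mem_ne (h : DirectSum.IsInternal G) {γ δ : Γ} (hne : γ ≠ δ) {x : X}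
    (hx : x ∈ G γ) : gradedProj h δ x = 0 := by
  simp [gradedProj, gradedEquiv_symm_of_mem h hx, DirectSum.component.of, hne]

theorem DirectSum.IsInternal.induction_on (h : DirectSum.IsInternal G) {p : X → Prop} (x : X)
    (mem : ∀ γ, ∀ x ∈ G γ, p x) (zero : p 0) (add : ∀ x y, p x → p y → p (x + y)) : p x := by
  have hx : x ∈ ⨆ γ, G γ := by rw [h.submodule_iSup_eq_top]; trivial
  exact Submodule.iSup_induction G (motive := p) hx mem zero add

theorem gradedProj_map (h : DirectSum.IsInternal G) (h' : DirectSum.IsInternal G')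
    (φ : X →ₗ[R] Y) (hφ : ∀ γ, ∀ x ∈ G γ, φ x ∈ G' γ) (γ : Γ) (x : X) :
    gradedProj h' γ (φ x) = φ (gradedProj h γ x) := by
  induction x using h.induction_on with
  | zero => simp
  | add x y hx hy => simp [hx, hy]
  | mem δ x hx =>
    by_cases hδ : δ = γ
    · subst hδ
      rw [gradedProj_of_mem h hx, gradedProj_of_mem h' (hφ _ _ hx)]
    · rw [gradedProj_of_mem_ne h hδ hx, gradedProj_of_mem_ne h' hδ (hφ _ _ hx), map_zero]

theorem mem_iSup_gradedProj (h : DirectSum.IsInternal G) (x : X) :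
    x ∈ ⨆ γ, Submodule.span R {gradedProj h γ x} := by
  classical
  obtain ⟨y, rfl⟩ := (gradedEquiv h).surjective x
  have hy : ∀ γ, gradedProj h γ (gradedEquiv h y) = y γ := fun γ => by
    simp only [gradedProj, LinearMap.comp_apply, LinearEquiv.coe_coe, LinearEquiv.symm_apply_apply]
    rfl
  simp only [hy]
  have hsum : gradedEquiv h y = ∑ γ ∈ DFinsupp.support y, (y γ : X) := by
    conv_lhs => rw [← DirectSum.sum_support_of y, map_sum]
    exact Finset.sum_congr rfl fun γ _ => DirectSum.coeLinearMap_lof G γ (y γ)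
  rw [hsum]
  exact Submodule.sum_mem _ fun γ _ =>
    Submodule.mem_iSup_of_mem γ (Submodule.mem_span_singleton_self _)

theorem iSup_inf_eq_self_iff (h : DirectSum.IsInternal G) (T : Submodule R X) :
    ⨆ γ, G γ ⊓ T = T ↔ ∀ x ∈ T, ∀ γ, gradedProj h γ x ∈ T := by
  constructor
  · intro hT x hx γ
    rw [← hT] at hx
    induction hx using Submodule.iSup_induction' with
    | zero => simp
    | add x y _ _ hx hy => rw [map_add]; exact T.add_mem hx hy
    | mem δ x hx =>
      by_cases hδ : δ = γ
      · subst hδ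
        rw [gradedProj_of_mem h hx.1]
        exact hx.2
      · rw [gradedProj_of_mem_ne h hδ hx.1]
        exact T.zero_mem
  · intro hT
    refine le_antisymm (iSup_le fun _ => inf_le_right) fun x hx => ?_
    have hle : ⨆ γ, Submodule.span R {gradedProj h γ x} ≤ ⨆ γ, G γ ⊓ T := by
      refine iSup_mono fun γ => ?_
      rw [Submodule.span_singleton_le_iff_mem]
      exact ⟨gradedProj_mem h γ x, hT x hx γ⟩
    exact hle (mem_iSup_gradedProj h x)

theorem iSup_inf_comap_eq_self (h : DirectSum.IsInternal G) (h' : DirectSum.IsInternal G')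
    (φ : X →ₗ[R] Y) (hφ : ∀ γ, ∀ x ∈ G γ, φ x ∈ G' γ) {T : Submodule R Y}
    (hT : ⨆ γ, G' γ ⊓ T = T) : ⨆ γ, G γ ⊓ T.comap φ = T.comap φ := by
  rw [iSup_inf_eq_self_iff h]
  intro x hx γ
  rw [Submodule.mem_comap, ← gradedProj_map h h' φ hφ]
  exact (iSup_inf_eq_self_iff h' T).1 hT _ hx γ

theorem isInternal_of_projections (π : Γ → X →ₗ[R] X) (hself : ∀ γ, ∀ x ∈ G γ, π γ x = x)
    (hne : ∀ γ δ, γ ≠ δ → ∀ x ∈ G γ, π δ x = 0) (htop : ⨆ γ, G γ = ⊤) :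
    DirectSum.IsInternal G := by
  refine DirectSum.isInternal_submodule_of_iSupIndep_of_iSup_eq_top (fun γ => ?_) htop
  rw [Submodule.disjoint_def]
  intro x hx hx'
  rw [← hself γ x hx]
  have : ⨆ (δ) (_ : δ ≠ γ), G δ ≤ LinearMap.ker (π γ) :=
    iSup₂_le fun δ hδ y hy => hne δ γ hδ y hy
  exact this hx'

end GradedProj

section GradedSubmodule

variable {Γ R X Y : Type*} [CommRing R] [AddCommGroup X] [Module R X]
  [AddCommGroup Y] [Module R Y] {G : Γ → Submodule R X} {G' : Γ → Submodule R Y}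

theorem iSup_inf_map_eq_self (φ : X →ₗ[R] Y) (hφ : ∀ γ, ∀ x ∈ G γ, φ x ∈ G' γ)
    {T : Submodule R X} (hT : ⨆ γ, G γ ⊓ T = T) : ⨆ γ, G' γ ⊓ T.map φ = T.map φ := by
  refine le_antisymm (iSup_le fun _ => inf_le_right) ?_
  conv_lhs => rw [← hT, Submodule.map_iSup]
  refine iSup_mono fun γ => ?_
  rintro _ ⟨x, hx, rfl⟩
  exact ⟨hφ γ x hx.1, x, hx.2, rfl⟩

theorem iSup_inf_sup_eq_self {S T : Submodule R X} (hS : ⨆ γ, G γ ⊓ S = S)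
    (hT : ⨆ γ, G γ ⊓ T = T) : ⨆ γ, G γ ⊓ (S ⊔ T) = S ⊔ T := by
  refine le_antisymm (iSup_le fun _ => inf_le_right) (sup_le ?_ ?_)
  · conv_lhs => rw [← hS]
    exact iSup_mono fun γ => inf_le_inf_left _ le_sup_left
  · conv_lhs => rw [← hT]
    exact iSup_mono fun γ => inf_le_inf_left _ le_sup_right

end GradedSubmodule

namespace GrMod

variable {Γ R A : Type u} [Monoid Γ] [DecidableEq Γ] [CommRing R] [Ring A] [Algebra R A]
  (𝒜 : GrAlgebra Γ R A)

/-- The component of degree `δ` of the free module on generators `i` of degree `deg i`. -/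
noncomputable def freeGrading {ι : Type u} (deg : ι → Γ) (δ : Γ) : Submodule R (ι →₀ A) :=
  Submodule.span R {f | ∃ i α a, a ∈ 𝒜.grading α ∧ α * deg i = δ ∧ Finsupp.single i a = f}

theorem single_mem_freeGrading {ι : Type u} (deg : ι → Γ) (i : ι) {α : Γ} {a : A}
    (ha : a ∈ 𝒜.grading α) : Finsupp.single i a ∈ freeGrading 𝒜 deg (α * deg i) :=
  Submodule.subset_span ⟨i, α, a, ha, rfl, rfl⟩

/-- The projection of `A` onto the sum of its components of degree `α` with `α * β = δ`. -/
noncomputable def shiftProj (β δ : Γ) : A →ₗ[R] A :=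
  DirectSum.toModule R Γ A (fun α => if α * β = δ then (𝒜.grading α).subtype else 0) ∘ₗ
    (gradedEquiv 𝒜.internal).symm.toLinearMap

theorem shiftProj_of_mem (β δ : Γ) {α : Γ} {a : A} (ha : a ∈ 𝒜.grading α) :
    shiftProj 𝒜 β δ a = if α * β = δ then a else 0 := by
  simp only [shiftProj, LinearMap.comp_apply, LinearEquiv.coe_coe,
    gradedEquiv_symm_of_mem 𝒜.internal ha, DirectSum.toModule_lof]
  split_ifs <;> simp

theorem isInternal_freeGrading {ι : Type u} (deg : ι → Γ) :
    DirectSum.IsInternal (freeGrading 𝒜 deg) := by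
  classical
  let π (δ : Γ) : (ι →₀ A) →ₗ[R] (ι →₀ A) :=
    Finsupp.lsum R fun i => Finsupp.lsingle i ∘ₗ shiftProj 𝒜 (deg i) δ
  have hπ (δ : Γ) (i : ι) (α : Γ) (a : A) (ha : a ∈ 𝒜.grading α) :
      π δ (Finsupp.single i a) = if α * deg i = δ then Finsupp.single i a else 0 := by
    simp only [π, Finsupp.lsum_single, LinearMap.comp_apply, shiftProj_of_mem 𝒜 _ _ ha]
    split_ifs <;> simp
  refine isInternal_of_projections π (fun γ x hx => ?_) (fun γ δ hγδ x hx => ?_) ?_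
  · induction hx using Submodule.span_induction with
    | mem x hx =>
      obtain ⟨i, α, a, ha, hα, rfl⟩ := hx
      rw [hπ _ _ _ _ ha, if_pos hα]
    | zero => simp
    | add x y _ _ hx hy => rw [map_add, hx, hy]
    | smul r x _ hx => rw [map_smul, hx]
  · induction hx using Submodule.span_induction with
    | mem x hx =>
      obtain ⟨i, α, a, ha, hα, rfl⟩ := hx
      rw [hπ _ _ _ _ ha, if_neg (hα ▸ hγδ)]
    | zero => simp
    | add x y _ _ hx hy => rw [map_add, hx, hy, add_zero]
    | smul r x _ hx => rw [map_smul, hx, smul_zero]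
  · rw [eq_top_iff]
    rintro f -
    induction f using Finsupp.induction_linear with
    | zero => exact Submodule.zero_mem _
    | add f g hf hg => exact Submodule.add_mem _ hf hg
    | single i a =>
      induction a using 𝒜.internal.induction_on with
      | mem α a ha => exact Submodule.mem_iSup_of_mem _ (single_mem_freeGrading 𝒜 deg i ha)
      | zero => simp
      | add a b ha hb => rw [Finsupp.single_add]; exact Submodule.add_mem _ ha hb

/-- The free graded module on generators `i` of degree `deg i`. -/
noncomputable def free {ι : Type u} (deg : ι → Γ) : GrMod 𝒜 where
  carrier := ι →₀ A
  grading := freeGrading 𝒜 deg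
  internal := isInternal_freeGrading 𝒜 deg
  smul_mem {γ δ a m} ha hm := by
    induction hm using Submodule.span_induction with
    | mem x hx =>
      obtain ⟨i, α, a', ha', rfl, rfl⟩ := hx
      rw [Finsupp.smul_single, smul_eq_mul, ← mul_assoc]
      exact single_mem_freeGrading 𝒜 deg i (𝒜.mul_mem ha ha')
    | zero => rw [smul_zero]; exact Submodule.zero_mem _
    | add x y _ _ hx hy => rw [smul_add]; exact Submodule.add_mem _ hx hy
    | smul r x _ hx => rw [smul_comm]; exact Submodule.smul_mem _ r hx

variable {𝒜}

theorem linearCombination_mem (P : GrMod 𝒜) {γ : Γ} {f : (Σ γ, P.grading γ) →₀ A}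
    (hf : f ∈ freeGrading 𝒜 Sigma.fst γ) :
    Finsupp.linearCombination A (fun i : Σ γ, P.grading γ => (i.2 : P.carrier)) f ∈
      P.grading γ := by
  induction hf using Submodule.span_induction with
  | mem x hx =>
    obtain ⟨i, α, a, ha, rfl, rfl⟩ := hx
    rw [Finsupp.linearCombination_single]
    exact P.smul_mem ha i.2.2
  | zero => rw [map_zero]; exact Submodule.zero_mem _
  | add x y _ _ hx hy => rw [map_add]; exact Submodule.add_mem _ hx hy
  | smul r x _ hx =>
    rw [LinearMap.map_smul_of_tower]
    exact Submodule.smul_mem _ r hx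

theorem linearCombination_surjective (P : GrMod 𝒜) : Function.Surjective
    (Finsupp.linearCombination A fun i : Σ γ, P.grading γ => (i.2 : P.carrier)) := by
  intro x
  induction x using P.internal.induction_on with
  | mem γ x hx =>
    exact ⟨Finsupp.single ⟨γ, x, hx⟩ 1, by simp⟩
  | zero => exact ⟨0, map_zero _⟩
  | add x y hx hy =>
    obtain ⟨a, rfl⟩ := hx
    obtain ⟨b, rfl⟩ := hy
    exact ⟨a + b, map_add _ _ _⟩

/-- The canonical map onto `P` from the free graded module on the homogeneous elements of `P`. -/
noncomputable def freeCover (P : GrMod 𝒜) :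
    GrHom (free 𝒜 (Sigma.fst : (Σ γ, P.grading γ) → Γ)) P where
  toLin := Finsupp.linearCombination A fun i : Σ γ, P.grading γ => (i.2 : P.carrier)
  map_grading _ _ hm := P.linearCombination_mem hm

theorem exists_section_of_grProjective {P : GrMod 𝒜} (hP : GrProjective P) :
    ∃ s : P.carrier →ₗ[A] ((Σ γ, P.grading γ) →₀ A),
      (∀ γ, ∀ m ∈ P.grading γ, s m ∈ freeGrading 𝒜 Sigma.fst γ) ∧
      ∀ m, Finsupp.linearCombination A (fun i : Σ γ, P.grading γ => (i.2 : P.carrier)) (s m) =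
        m := by
  obtain ⟨s, hs⟩ := hP _ _ (freeCover P) ⟨LinearMap.id, fun _ _ h => h⟩
    P.linearCombination_surjective
  exact ⟨s.toLin, s.map_grading, fun m => LinearMap.congr_fun hs m⟩

end GrMod

section TwistedProduct

variable {Γ R A B : Type u} [Monoid Γ] [DecidableEq Γ] [CommRing R] [Ring A] [Algebra R A]
  [Ring B] [Algebra R B] {𝒜 : GrAlgebra Γ R A} {ρ : GammaAlgebra Γ R B}
  {mul : (A ⊗[R] B) →ₗ[R] (A ⊗[R] B) →ₗ[R] (A ⊗[R] B)}
  {X Y : Type u} [AddCommGroup X] [Module R X] [AddCommGroup Y] [Module R Y]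

namespace TwModStr

theorem act_one_tmul_mem (sX : TwModStr 𝒜 mul X) (b : B) (γ : Γ) (x : X)
    (hx : x ∈ sX.grading γ) : sX.act ((1 : A) ⊗ₜ[R] b) x ∈ sX.grading γ := by
  simpa using sX.act_mem (b := b) 𝒜.one_mem hx

theorem act_act_of_mem
    (hmul : ∀ (β : Γ) (a a' : A) (b b' : B), a' ∈ 𝒜.grading β →
      mul (a ⊗ₜ[R] b) (a' ⊗ₜ[R] b') = (a * a') ⊗ₜ[R] (ρ.act β b * b'))
    (sX : TwModStr 𝒜 mul X) {α : Γ} (a : A) {a' : A} (ha' : a' ∈ 𝒜.grading α) (b b' : B)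
    (x : X) : sX.act (a ⊗ₜ[R] b) (sX.act (a' ⊗ₜ[R] b') x) =
      sX.act ((a * a') ⊗ₜ[R] (ρ.act α b * b')) x := by
  rw [← sX.mul_act, hmul α _ _ _ _ ha']

theorem act_one_tmul_mul
    (hmul : ∀ (β : Γ) (a a' : A) (b b' : B), a' ∈ 𝒜.grading β →
      mul (a ⊗ₜ[R] b) (a' ⊗ₜ[R] b') = (a * a') ⊗ₜ[R] (ρ.act β b * b'))
    (sX : TwModStr 𝒜 mul X) (b b' : B) (x : X) :
    sX.act ((1 : A) ⊗ₜ[R] (b * b')) x =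
      sX.act ((1 : A) ⊗ₜ[R] b) (sX.act ((1 : A) ⊗ₜ[R] b') x) := by
  rw [act_act_of_mem hmul sX 1 𝒜.one_mem, ρ.act_one, one_mul, AlgHom.id_apply]

/-- The `B`-module underlying an `A ⋉_Γ B`-module. -/
noncomputable abbrev moduleB
    (hmul : ∀ (β : Γ) (a a' : A) (b b' : B), a' ∈ 𝒜.grading β →
      mul (a ⊗ₜ[R] b) (a' ⊗ₜ[R] b') = (a * a') ⊗ₜ[R] (ρ.act β b * b'))
    (sX : TwModStr 𝒜 mul X) : Module B X where
  smul b x := sX.act ((1 : A) ⊗ₜ[R] b) x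
  one_smul := sX.one_act
  mul_smul := act_one_tmul_mul hmul sX
  smul_zero _ := map_zero _
  smul_add _ := map_add _
  add_smul b b' x := by
    change sX.act _ x = sX.act _ x + sX.act _ x
    rw [TensorProduct.tmul_add, map_add, LinearMap.add_apply]
  zero_smul x := by
    change sX.act _ x = 0
    rw [TensorProduct.tmul_zero, map_zero, LinearMap.zero_apply]

/-- A degree `γ` homogeneous twisted `B`-linear map `_γ N → Y` lifts along surjections. -/
theorem exists_lift
    (hmul : ∀ (β : Γ) (a a' : A) (b b' : B), a' ∈ 𝒜.grading β →
      mul (a ⊗ₜ[R] b) (a' ⊗ₜ[R] b') = (a * a') ⊗ₜ[R] (ρ.act β b * b'))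
    {N : Type u} [AddCommGroup N] [Module R N] [Module B N] [IsScalarTower R B N]
    {γ : Γ} (hN : Module.Projective B (TwistB ρ γ N))
    {sX : TwModStr 𝒜 mul X} {sY : TwModStr 𝒜 mul Y} {f : X →ₗ[R] Y} (hf : IsTwHom sX sY f)
    (hfs : Function.Surjective f) (q : N →ₗ[R] Y) (hq : ∀ x, q x ∈ sY.grading γ)
    (hqB : ∀ b x, q (ρ.act γ b • x) = sY.act ((1 : A) ⊗ₜ[R] b) (q x)) :
    ∃ h : N →ₗ[R] X, (∀ x, h x ∈ sX.grading γ) ∧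
      (∀ b x, h (ρ.act γ b • x) = sX.act ((1 : A) ⊗ₜ[R] b) (h x)) ∧ ∀ x, f (h x) = q x := by
  let := moduleB hmul sX
  let := moduleB hmul sY
  let fB : X →ₗ[B] Y := { f with map_smul' := fun b x => hf.1 _ x }
  let qB : TwistB ρ γ N →ₗ[B] Y := { toFun := q, map_add' := q.map_add, map_smul' := hqB }
  obtain ⟨h, hh⟩ := Module.projective_lifting_property fB qB hfs
  have hB : ∀ (b : B) (x : N), h (ρ.act γ b • x : N) = sX.act ((1 : A) ⊗ₜ[R] b) (h x) :=
    fun b x => h.map_smul b x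
  let hR : N →ₗ[R] X :=
    { toFun := h
      map_add' := h.map_add
      map_smul' := fun r x => by
        have := hB (algebraMap R B r) x
        rw [AlgHom.commutes, algebraMap_smul, Algebra.algebraMap_eq_smul_one,
          TensorProduct.tmul_smul, map_smul, LinearMap.smul_apply, sX.one_act] at this
        exact this }
  refine ⟨gradedProj sX.internal γ ∘ₗ hR, fun x => gradedProj_mem _ _ _, fun b x => ?_,
    fun x => ?_⟩
  · have := gradedProj_map sX.internal sX.internal (sX.act ((1 : A) ⊗ₜ[R] b))
      (sX.act_one_tmul_mem b) γ (hR x)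
    rw [LinearMap.comp_apply, LinearMap.comp_apply, ← this]
    exact congrArg _ (hB b x)
  · have hfh : f (hR x) = q x := LinearMap.congr_fun hh x
    rw [LinearMap.comp_apply, ← gradedProj_map sX.internal sY.internal f hf.2, hfh,
      gradedProj_of_mem _ (hq x)]

end TwModStr

variable {N : Type u} [AddCommGroup N] [Module R N] {P Q : GrMod 𝒜}
  {sP : TwModStr 𝒜 mul (P.carrier ⊗[R] N)} {sQ : TwModStr 𝒜 mul (Q.carrier ⊗[R] N)}

theorem tmul_mem_grading
    (hgr : ∀ γ : Γ, sP.grading γ =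
      LinearMap.range (TensorProduct.map (P.grading γ).subtype (LinearMap.id : N →ₗ[R] N)))
    {γ : Γ} {m : P.carrier} (hm : m ∈ P.grading γ) (x : N) : m ⊗ₜ[R] x ∈ sP.grading γ := by
  rw [hgr]
  exact ⟨⟨m, hm⟩ ⊗ₜ x, rfl⟩

theorem grading_induction
    (hgr : ∀ γ : Γ, sP.grading γ =
      LinearMap.range (TensorProduct.map (P.grading γ).subtype (LinearMap.id : N →ₗ[R] N)))
    {γ : Γ} {T : Submodule R (P.carrier ⊗[R] N)}
    (hT : ∀ m ∈ P.grading γ, ∀ x : N, m ⊗ₜ[R] x ∈ T) : sP.grading γ ≤ T := by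
  rw [hgr]
  rintro _ ⟨z, rfl⟩
  induction z using TensorProduct.induction_on with
  | zero => simp
  | tmul m x => exact hT m m.2 x
  | add y z hy hz => rw [map_add]; exact T.add_mem hy hz

variable [Module B N]

theorem isTwHom_of_tmul
    (hact : ∀ (γ : Γ) (a : A) (b : B) (m : P.carrier) (x : N), m ∈ P.grading γ →
      sP.act (a ⊗ₜ[R] b) (m ⊗ₜ[R] x) = (a • m) ⊗ₜ[R] (ρ.act γ b • x))
    (hgr : ∀ γ : Γ, sP.grading γ =
      LinearMap.range (TensorProduct.map (P.grading γ).subtype (LinearMap.id : N →ₗ[R] N)))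
    {sX : TwModStr 𝒜 mul X} (f : P.carrier ⊗[R] N →ₗ[R] X)
    (hf : ∀ γ, ∀ m ∈ P.grading γ, ∀ (a : A) (b : B) (x : N),
      f ((a • m) ⊗ₜ[R] (ρ.act γ b • x)) = sX.act (a ⊗ₜ[R] b) (f (m ⊗ₜ[R] x)))
    (hfgr : ∀ γ, ∀ m ∈ P.grading γ, ∀ x : N, f (m ⊗ₜ[R] x) ∈ sX.grading γ) :
    IsTwHom sP sX f := by
  refine ⟨fun p z => ?_, fun γ => grading_induction hgr (T := (sX.grading γ).comap f) (hfgr γ)⟩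
  induction p using TensorProduct.induction_on with
  | zero => simp
  | add p q hp hq => simp only [map_add, LinearMap.add_apply, hp, hq]
  | tmul a b =>
    induction z using TensorProduct.induction_on with
    | zero => simp
    | add y z hy hz => simp only [map_add, hy, hz]
    | tmul m x =>
      induction m using P.internal.induction_on with
      | zero => simp
      | add m n hm hn => simp only [TensorProduct.add_tmul, map_add, hm, hn]
      | mem γ m hm => rw [hact γ a b m x hm, hf γ m hm]

theorem isTwHom_map
    (hactP : ∀ (γ : Γ) (a : A) (b : B) (m : P.carrier) (x : N), m ∈ P.grading γ →
      sP.act (a ⊗ₜ[R] b) (m ⊗ₜ[R] x) = (a • m) ⊗ₜ[R] (ρ.act γ b • x))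
    (hgrP : ∀ γ : Γ, sP.grading γ =
      LinearMap.range (TensorProduct.map (P.grading γ).subtype (LinearMap.id : N →ₗ[R] N)))
    (hactQ : ∀ (γ : Γ) (a : A) (b : B) (m : Q.carrier) (x : N), m ∈ Q.grading γ →
      sQ.act (a ⊗ₜ[R] b) (m ⊗ₜ[R] x) = (a • m) ⊗ₜ[R] (ρ.act γ b • x))
    (hgrQ : ∀ γ : Γ, sQ.grading γ =
      LinearMap.range (TensorProduct.map (Q.grading γ).subtype (LinearMap.id : N →ₗ[R] N)))
    (f : GrHom P Q) :
    IsTwHom sP sQ (TensorProduct.map (f.toLin.restrictScalars R) (LinearMap.id : N →ₗ[R] N)) := by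
  refine isTwHom_of_tmul hactP hgrP _ (fun γ m hm a b x => ?_) fun γ m hm x => ?_
  · simp [hactQ γ a b _ x (f.map_grading γ m hm)]
  · exact tmul_mem_grading hgrQ (f.map_grading γ m hm) x

theorem twProjective_tensor [IsScalarTower R B N]
    (hmul : ∀ (β : Γ) (a a' : A) (b b' : B), a' ∈ 𝒜.grading β →
      mul (a ⊗ₜ[R] b) (a' ⊗ₜ[R] b') = (a * a') ⊗ₜ[R] (ρ.act β b * b'))
    (hN : ∀ β : Γ, Module.Projective B (TwistB ρ β N)) (hP : GrProjective P)
    (hact : ∀ (γ : Γ) (a : A) (b : B) (m : P.carrier) (x : N), m ∈ P.grading γ →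
      sP.act (a ⊗ₜ[R] b) (m ⊗ₜ[R] x) = (a • m) ⊗ₜ[R] (ρ.act γ b • x))
    (hgr : ∀ γ : Γ, sP.grading γ =
      LinearMap.range (TensorProduct.map (P.grading γ).subtype (LinearMap.id : N →ₗ[R] N))) :
    TwProjective sP := by
  intro X Y _ _ _ _ sX sY f g hf hfs hg
  obtain ⟨s, hsgr, hs⟩ := GrMod.exists_section_of_grProjective hP
  have hlift (i : Σ γ, P.grading γ) := TwModStr.exists_lift hmul (hN i.1) hf hfs
    (g ∘ₗ TensorProduct.mk R P.carrier N i.2)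
    (fun x => hg.2 _ _ (tmul_mem_grading hgr i.2.2 x)) (fun b x => by
      have := hact i.1 1 b i.2 x i.2.2
      rw [one_smul] at this
      simp only [LinearMap.comp_apply, TensorProduct.mk_apply, ← this, hg.1])
  choose l hlgr hlB hfl using hlift
  let φ : ((Σ γ, P.grading γ) →₀ A) →ₗ[R] N →ₗ[R] X := Finsupp.lsum R fun i =>
    LinearMap.mk₂ R (fun a x => sX.act (a ⊗ₜ[R] (1 : B)) (l i x))
      (fun a a' x => by simp [TensorProduct.add_tmul])
      (fun r a x => by simp [← TensorProduct.smul_tmul'])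
      (fun a x y => by simp) (fun r a x => by simp)
  have hφ (i : Σ γ, P.grading γ) (a : A) (x : N) :
      φ (Finsupp.single i a) x = sX.act (a ⊗ₜ[R] (1 : B)) (l i x) := by
    simp [φ]
  have hφgr (γ : Γ) (z : (Σ γ, P.grading γ) →₀ A) (hz : z ∈ GrMod.freeGrading 𝒜 Sigma.fst γ)
      (x : N) : φ z x ∈ sX.grading γ := by
    induction hz using Submodule.span_induction with
    | mem z hz =>
      obtain ⟨i, α, a, ha, rfl, rfl⟩ := hz
      rw [hφ]
      exact sX.act_mem ha (hlgr i x)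
    | zero => simp
    | add y z _ _ hy hz => rw [map_add]; exact Submodule.add_mem _ hy hz
    | smul r z _ hz => rw [map_smul]; exact Submodule.smul_mem _ r hz
  have hφact (γ : Γ) (z : (Σ γ, P.grading γ) →₀ A)
      (hz : z ∈ GrMod.freeGrading 𝒜 Sigma.fst γ) (a : A) (b : B) (x : N) :
      φ (a • z) (ρ.act γ b • x) = sX.act (a ⊗ₜ[R] b) (φ z x) := by
    induction hz using Submodule.span_induction with
    | mem z hz =>
      obtain ⟨i, α, a', ha', rfl, rfl⟩ := hz
      rw [Finsupp.smul_single, hφ, hφ, ρ.act_mul, AlgHom.comp_apply, hlB, smul_eq_mul,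
        TwModStr.act_act_of_mem hmul sX _ 𝒜.one_mem, TwModStr.act_act_of_mem hmul sX _ ha']
      simp
    | zero => simp
    | add y z _ _ hy hz => simp only [smul_add, map_add, LinearMap.add_apply, hy, hz]
    | smul r z _ hz => rw [smul_comm, map_smul φ, map_smul φ, LinearMap.smul_apply, hz,
        LinearMap.smul_apply, map_smul]
  have hfφ (z : (Σ γ, P.grading γ) →₀ A) (x : N) : f (φ z x) =
      g (Finsupp.linearCombination A (fun i : Σ γ, P.grading γ => (i.2 : P.carrier)) z ⊗ₜ x) := by
    induction z using Finsupp.induction_linear with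
    | zero => simp
    | add y z hy hz => simp only [map_add, LinearMap.add_apply, hy, hz, TensorProduct.add_tmul]
    | single i a =>
      rw [hφ, hf.1, hfl, Finsupp.linearCombination_single, LinearMap.comp_apply,
        TensorProduct.mk_apply, ← hg.1, hact i.1 a 1 _ x i.2.2, map_one, one_smul]
  refine ⟨TensorProduct.lift (φ ∘ₗ s.restrictScalars R),
    isTwHom_of_tmul hact hgr _ (fun γ m hm a b x => ?_) fun γ m hm x => ?_,
    TensorProduct.ext' fun m x => ?_⟩
  · simp [hφact γ _ (hsgr γ m hm)]
  · exact hφgr γ _ (hsgr γ m hm) x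
  · simp [hfφ, hs]

theorem act_tmul_one
    (hact : ∀ (γ : Γ) (a : A) (b : B) (m : P.carrier) (x : N), m ∈ P.grading γ →
      sP.act (a ⊗ₜ[R] b) (m ⊗ₜ[R] x) = (a • m) ⊗ₜ[R] (ρ.act γ b • x))
    (a : A) (m : P.carrier) (x : N) :
    sP.act (a ⊗ₜ[R] (1 : B)) (m ⊗ₜ[R] x) = (a • m) ⊗ₜ[R] x := by
  induction m using P.internal.induction_on with
  | zero => simp
  | add m n hm hn => simp only [TensorProduct.add_tmul, map_add, smul_add, hm, hn]
  | mem γ m hm => rw [hact γ a 1 m x hm, map_one, one_smul]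

theorem eq_top_of_map_mk_sup_eq_top
    (hact : ∀ (γ : Γ) (a : A) (b : B) (m : P.carrier) (x : N), m ∈ P.grading γ →
      sP.act (a ⊗ₜ[R] b) (m ⊗ₜ[R] x) = (a • m) ⊗ₜ[R] (ρ.act γ b • x))
    (hgr : ∀ γ : Γ, sP.grading γ =
      LinearMap.range (TensorProduct.map (P.grading γ).subtype (LinearMap.id : N →ₗ[R] N)))
    {K : Submodule A P.carrier} (hK : GrSuperfluous P K) (x : N)
    {T : Submodule R (P.carrier ⊗[R] N)}
    (hTA : ∀ a : A, ∀ t ∈ T, sP.act (a ⊗ₜ[R] (1 : B)) t ∈ T) (hT : ⨆ γ, sP.grading γ ⊓ T = T)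
    (htop : (K.restrictScalars R).map ((TensorProduct.mk R P.carrier N).flip x) ⊔ T = ⊤) :
    T = ⊤ := by
  let S : Submodule A P.carrier :=
    { T.comap ((TensorProduct.mk R P.carrier N).flip x) with
      smul_mem' := fun a m hm => by
        have := hTA a _ hm
        simp only [LinearMap.flip_apply, TensorProduct.mk_apply, act_tmul_one hact] at this
        exact this }
  have hmem (m : P.carrier) : m ∈ S ↔ m ⊗ₜ[R] x ∈ T := Iff.rfl
  have hS : S = ⊤ := by
    refine hK S ?_ ?_
    · exact iSup_inf_comap_eq_self P.internal sP.internal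
        ((TensorProduct.mk R P.carrier N).flip x) (fun γ m hm => tmul_mem_grading hgr hm x) hT
    · rw [eq_top_iff]
      rintro m -
      have hm : m ⊗ₜ[R] x ∈ (⊤ : Submodule R (P.carrier ⊗[R] N)) := trivial
      rw [← htop, Submodule.mem_sup] at hm
      obtain ⟨_, ⟨k, hk, rfl⟩, t, ht, hkt⟩ := hm
      refine Submodule.mem_sup.2 ⟨k, hk, m - k, ?_, by abel⟩
      rw [hmem, TensorProduct.sub_tmul, ← hkt]
      simpa using ht
  rw [← htop, eq_comm, sup_eq_right]
  rintro _ ⟨k, -, rfl⟩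
  have : k ∈ S := hS ▸ trivial
  exact this

theorem eq_top_of_iSup_map_mk_sup_eq_top
    (hact : ∀ (γ : Γ) (a : A) (b : B) (m : P.carrier) (x : N), m ∈ P.grading γ →
      sP.act (a ⊗ₜ[R] b) (m ⊗ₜ[R] x) = (a • m) ⊗ₜ[R] (ρ.act γ b • x))
    (hgr : ∀ γ : Γ, sP.grading γ =
      LinearMap.range (TensorProduct.map (P.grading γ).subtype (LinearMap.id : N →ₗ[R] N)))
    {K : Submodule A P.carrier} (hKgr : IsGrSubmodule P K) (hK : GrSuperfluous P K)
    (s : Finset N) {T : Submodule R (P.carrier ⊗[R] N)}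
    (hTA : ∀ a : A, ∀ t ∈ T, sP.act (a ⊗ₜ[R] (1 : B)) t ∈ T) (hT : ⨆ γ, sP.grading γ ⊓ T = T)
    (htop : (⨆ x ∈ s, (K.restrictScalars R).map ((TensorProduct.mk R P.carrier N).flip x)) ⊔ T =
      ⊤) : T = ⊤ := by
  classical
  induction s using Finset.induction_on generalizing T with
  | empty => simpa using htop
  | insert x s _ ih =>
    rw [Finset.iSup_insert, sup_right_comm, sup_comm] at htop
    refine eq_top_of_map_mk_sup_eq_top hact hgr hK x hTA hT (ih ?_ ?_ htop)
    · intro a t ht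
      obtain ⟨_, ⟨k, hk, rfl⟩, t', ht', rfl⟩ := Submodule.mem_sup.1 ht
      rw [map_add]
      refine Submodule.add_mem_sup ⟨a • k, K.smul_mem a hk, ?_⟩ (hTA a t' ht')
      exact (act_tmul_one hact a k x).symm
    · exact iSup_inf_sup_eq_self (iSup_inf_map_eq_self _
        (fun γ m hm => tmul_mem_grading hgr hm x) hKgr) hT

theorem isGrSubmodule_ker (f : GrHom P Q) : IsGrSubmodule P (LinearMap.ker f.toLin) :=
  iSup_inf_comap_eq_self P.internal Q.internal (f.toLin.restrictScalars R) f.map_grading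
    (T := ⊥) (by simp)

theorem range_map_le_iSup {M : Type u} [AddCommGroup M] [Module R M]
    (f : M →ₗ[R] P.carrier) {K : Submodule R P.carrier} (hK : LinearMap.range f ≤ K)
    {s : Finset N} (hs : Submodule.span R (s : Set N) = ⊤) :
    LinearMap.range (TensorProduct.map f (LinearMap.id : N →ₗ[R] N)) ≤
      ⨆ x ∈ s, K.map ((TensorProduct.mk R P.carrier N).flip x) := by
  rintro _ ⟨z, rfl⟩
  induction z using TensorProduct.induction_on with
  | zero => simp
  | add y z hy hz => rw [map_add]; exact Submodule.add_mem _ hy hz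
  | tmul m y =>
    have hy : y ∈ Submodule.span R (s : Set N) := hs ▸ trivial
    rw [TensorProduct.map_tmul, LinearMap.id_apply]
    induction hy using Submodule.span_induction with
    | mem x hx => exact Submodule.mem_iSup_of_mem x (Submodule.mem_iSup_of_mem hx
        ⟨f m, hK ⟨m, rfl⟩, rfl⟩)
    | zero => simp
    | add x y _ _ hx hy => rw [TensorProduct.tmul_add]; exact Submodule.add_mem _ hx hy
    | smul r x _ hx => rw [TensorProduct.tmul_smul]; exact Submodule.smul_mem _ r hx

/-- If `range d = ker f` is superfluous, then so is the kernel of `f ⊗ N`. -/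
theorem eq_top_of_ker_map_sup_eq_top [Module.Finite R N] {L : GrMod 𝒜}
    (hact : ∀ (γ : Γ) (a : A) (b : B) (m : P.carrier) (x : N), m ∈ P.grading γ →
      sP.act (a ⊗ₜ[R] b) (m ⊗ₜ[R] x) = (a • m) ⊗ₜ[R] (ρ.act γ b • x))
    (hgr : ∀ γ : Γ, sP.grading γ =
      LinearMap.range (TensorProduct.map (P.grading γ).subtype (LinearMap.id : N →ₗ[R] N)))
    (f : GrHom P Q) (d : GrHom L P) (hd : LinearMap.range d.toLin = LinearMap.ker f.toLin)
    (hdN : LinearMap.range (TensorProduct.map (d.toLin.restrictScalars R)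
        (LinearMap.id : N →ₗ[R] N)) =
      LinearMap.ker (TensorProduct.map (f.toLin.restrictScalars R) (LinearMap.id : N →ₗ[R] N)))
    (hf : GrSuperfluous P (LinearMap.ker f.toLin)) {T : Submodule R (P.carrier ⊗[R] N)}
    (hT : IsTwSubmodule sP T)
    (htop : LinearMap.ker (TensorProduct.map (f.toLin.restrictScalars R)
      (LinearMap.id : N →ₗ[R] N)) ⊔ T = ⊤) : T = ⊤ := by
  obtain ⟨s, hs⟩ := Module.Finite.fg_top (R := R) (M := N)
  refine eq_top_of_iSup_map_mk_sup_eq_top hact hgr (isGrSubmodule_ker f) hf s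
    (fun a t ht => hT.1 _ t ht) hT.2 (top_unique ?_)
  rw [← htop, ← hdN]
  refine sup_le_sup_right (range_map_le_iSup _ ?_ hs) T
  exact fun m hm => hd.le hm

end TwistedProduct

/-- The functor `− ⋉_Γ N` preserves minimal projective resolutions.  Let `N` be a
`B`-module which is flat and finitely generated over `R` and with all twists `_β N`
projective over `B`.  If `P_• → M → 0` is a minimal projective resolution in `A`-`Γ`-gr,
then `P_• ⋉_Γ N → M ⋉_Γ N → 0` is a minimal projective resolution in the category of
`Γ`-graded `A ⋉_Γ B`-modules. -/
theorem twistedProduct_minimal_resolution {Γ R A B : Type u} [Monoid Γ] [DecidableEq Γ]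
    [CommRing R] [Ring A] [Algebra R A] [Ring B] [Algebra R B]
    (𝒜 : GrAlgebra Γ R A) (ρ : GammaAlgebra Γ R B)
    (mul : (A ⊗[R] B) →ₗ[R] (A ⊗[R] B) →ₗ[R] (A ⊗[R] B))
    (hmul : ∀ (β : Γ) (a a' : A) (b b' : B), a' ∈ 𝒜.grading β →
      mul (a ⊗ₜ[R] b) (a' ⊗ₜ[R] b') = (a * a') ⊗ₜ[R] (ρ.act β b * b'))
    (N : Type u) [AddCommGroup N] [Module R N] [Module B N] [IsScalarTower R B N]
    [Module.Finite R N] [Module.Flat R N]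
    (hNproj : ∀ β : Γ, Module.Projective B (TwistB ρ β N))
    -- a minimal projective resolution `P_• → M → 0` in `A`-`Γ`-gr:
    (M : GrMod 𝒜) (P : ℕ → GrMod 𝒜)
    (d : ∀ k, GrHom (P (k + 1)) (P k)) (aug : GrHom (P 0) M)
    (hproj : ∀ k, GrProjective (P k))
    (hsurj : Function.Surjective aug.toLin)
    (hex0 : LinearMap.range (d 0).toLin = LinearMap.ker aug.toLin)
    (hex : ∀ k, LinearMap.range (d (k + 1)).toLin = LinearMap.ker (d k).toLin)
    (hmin0 : GrSuperfluous (P 0) (LinearMap.ker aug.toLin))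
    (hmin : ∀ k, GrSuperfluous (P (k + 1)) (LinearMap.ker (d k).toLin))
    -- the twisted modules `P k ⋉_Γ N` and `M ⋉_Γ N`:
    (sQ : ∀ k, TwModStr 𝒜 mul ((P k).carrier ⊗[R] N))
    (sQM : TwModStr 𝒜 mul (M.carrier ⊗[R] N))
    (hactQ : ∀ (k : ℕ) (γ : Γ) (a : A) (b : B) (m : (P k).carrier) (x : N),
      m ∈ (P k).grading γ →
      (sQ k).act (a ⊗ₜ[R] b) (m ⊗ₜ[R] x) = (a • m) ⊗ₜ[R] (ρ.act γ b • x))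
    (hgrQ : ∀ (k : ℕ) (γ : Γ), (sQ k).grading γ =
      LinearMap.range (TensorProduct.map ((P k).grading γ).subtype
        (LinearMap.id : N →ₗ[R] N)))
    (hactQM : ∀ (γ : Γ) (a : A) (b : B) (m : M.carrier) (x : N), m ∈ M.grading γ →
      sQM.act (a ⊗ₜ[R] b) (m ⊗ₜ[R] x) = (a • m) ⊗ₜ[R] (ρ.act γ b • x))
    (hgrQM : ∀ γ : Γ, sQM.grading γ =
      LinearMap.range (TensorProduct.map (M.grading γ).subtype
        (LinearMap.id : N →ₗ[R] N))) :
    -- `P_• ⋉_Γ N → M ⋉_Γ N → 0` is a minimal projective resolution in `(A ⋉_Γ B)`-`Γ`-gr: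
    (∀ k, TwProjective (sQ k)) ∧
    (∀ k, IsTwHom (sQ (k + 1)) (sQ k)
      (TensorProduct.map ((d k).toLin.restrictScalars R) (LinearMap.id : N →ₗ[R] N))) ∧
    IsTwHom (sQ 0) sQM
      (TensorProduct.map (aug.toLin.restrictScalars R) (LinearMap.id : N →ₗ[R] N)) ∧
    Function.Surjective
      (TensorProduct.map (aug.toLin.restrictScalars R) (LinearMap.id : N →ₗ[R] N)) ∧
    LinearMap.range
        (TensorProduct.map ((d 0).toLin.restrictScalars R) (LinearMap.id : N →ₗ[R] N)) =
      LinearMap.ker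
        (TensorProduct.map (aug.toLin.restrictScalars R) (LinearMap.id : N →ₗ[R] N)) ∧
    (∀ k, LinearMap.range (TensorProduct.map ((d (k + 1)).toLin.restrictScalars R)
        (LinearMap.id : N →ₗ[R] N)) =
      LinearMap.ker (TensorProduct.map ((d k).toLin.restrictScalars R)
        (LinearMap.id : N →ₗ[R] N))) ∧
    (∀ T : Submodule R ((P 0).carrier ⊗[R] N), IsTwSubmodule (sQ 0) T →
      LinearMap.ker (TensorProduct.map (aug.toLin.restrictScalars R)
        (LinearMap.id : N →ₗ[R] N)) ⊔ T = ⊤ → T = ⊤) ∧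
    (∀ (k : ℕ) (T : Submodule R ((P (k + 1)).carrier ⊗[R] N)),
      IsTwSubmodule (sQ (k + 1)) T →
      LinearMap.ker (TensorProduct.map ((d k).toLin.restrictScalars R)
        (LinearMap.id : N →ₗ[R] N)) ⊔ T = ⊤ → T = ⊤) := by
  have hsurjN : Function.Surjective (TensorProduct.map (aug.toLin.restrictScalars R)
      (LinearMap.id : N →ₗ[R] N)) := TensorProduct.map_surjective hsurj Function.surjective_id
  have hex0N := LinearMap.exact_iff.1 (rTensor_exact N
    (f := (d 0).toLin.restrictScalars R) (g := aug.toLin.restrictScalars R)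
    (LinearMap.exact_iff.2 hex0.symm :) hsurj)
  have hexN (k : ℕ) := LinearMap.exact_iff.1 (Module.Flat.rTensor_exact N
    (f := (d (k + 1)).toLin.restrictScalars R) (g := (d k).toLin.restrictScalars R)
    (LinearMap.exact_iff.2 (hex k).symm :))
  exact ⟨fun k => twProjective_tensor hmul hNproj (hproj k) (hactQ k) (hgrQ k),
    fun k => isTwHom_map (hactQ _) (hgrQ _) (hactQ _) (hgrQ _) (d k),
    isTwHom_map (hactQ 0) (hgrQ 0) hactQM hgrQM aug, hsurjN, hex0N.symm,
    fun k => (hexN k).symm,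
    fun T hT => eq_top_of_ker_map_sup_eq_top (hactQ 0) (hgrQ 0) aug (d 0) hex0 hex0N.symm hmin0 hT,
    fun k T hT => eq_top_of_ker_map_sup_eq_top (hactQ _) (hgrQ _) (d k) (d (k + 1)) (hex k)
      (hexN k).symm (hmin k) hT⟩
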